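/- arXiv:1703.06518 — 2 statements merged into one kernel-verified Lean document; each statement's English description precedes it below -/
import Mathlib

section
/- Let P₁ be the self-similar measure satisfying P₁ = (1/2)P₁∘S₁⁻¹ + (1/2)P₁∘S₂⁻¹ with S₁(x)=x/3, S₂(x)=x/3+1/3, P₂ the uniform discrete measure on {2/3, 5/6, 1}, and P = (1/2)P₁ + (1/2)P₂. Then {1/12, 31/60, 11/12} is an optimal set of three-means for P, with quantization error V₃(P) = 89/8640. -/
open MeasureTheory Set Filter Real
open scoped ENNReal

/-- Distortion error of a finite set of quantizers `γ` for the measure `P`. -/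
noncomputable def distortion (P : Measure ℝ) (γ : Finset ℝ) : ℝ :=
  ∫ x, (⨅ c : γ, (x - (c : ℝ)) ^ 2) ∂P

/-- The `n`-th quantization error of `P`. -/
noncomputable def quantErr (P : Measure ℝ) (n : ℕ) : ℝ :=
  sInf {v : ℝ | ∃ γ : Finset ℝ, γ.Nonempty ∧ γ.card ≤ n ∧ v = distortion P γ}

/-- `γ` is an optimal set of `n`-means for `P`. -/
def IsOptimalSet (P : Measure ℝ) (n : ℕ) (γ : Finset ℝ) : Prop :=
  γ.Nonempty ∧ γ.card ≤ n ∧ distortion P γ = quantErr P n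

/-- Uniform distribution on `[a, b]`. -/
noncomputable def unif (a b : ℝ) : Measure ℝ :=
  (ENNReal.ofReal (b - a))⁻¹ • (volume.restrict (Icc a b))

/-- The uniform discrete measure on `{2/3, 5/6, 1}`. -/
noncomputable def discD : Measure ℝ :=
  (3 : ℝ≥0∞)⁻¹ • (Measure.dirac (2/3) + Measure.dirac (5/6) + Measure.dirac 1)

/-- Mixture `(1/2)P₁ + (1/2)P₂`. -/
noncomputable def mix (P₁ P₂ : Measure ℝ) : Measure ℝ :=
  (2 : ℝ≥0∞)⁻¹ • P₁ + (2 : ℝ≥0∞)⁻¹ • P₂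

/-- The squared distance from `x` to the nearest of the points `a`, `b`, `c`. -/
noncomputable def minSq (a b c x : ℝ) : ℝ :=
  min ((x - a) ^ 2) (min ((x - b) ^ 2) ((x - c) ^ 2))

lemma minSq_nonneg (a b c x : ℝ) : 0 ≤ minSq a b c x :=
  le_min (sq_nonneg _) (le_min (sq_nonneg _) (sq_nonneg _))

lemma continuous_minSq (a b c : ℝ) : Continuous (minSq a b c) := by
  unfold minSq
  fun_prop

lemma sq_left_le_minSq {a b c x : ℝ} (hab : a ≤ b) (hbc : b ≤ c) (h : x ≤ (a + b) / 2) :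
    (x - a) ^ 2 ≤ minSq a b c x :=
  le_min le_rfl (le_min (by nlinarith) (by nlinarith))

lemma sq_middle_le_minSq {a b c x : ℝ} (hab : a ≤ b) (hbc : b ≤ c) (h : (a + b) / 2 ≤ x)
    (h' : x ≤ (b + c) / 2) : (x - b) ^ 2 ≤ minSq a b c x :=
  le_min (by nlinarith) (le_min le_rfl (by nlinarith))

lemma sq_right_le_minSq {a b c x : ℝ} (hab : a ≤ b) (hbc : b ≤ c) (h : (b + c) / 2 ≤ x) :
    (x - c) ^ 2 ≤ minSq a b c x :=
  le_min (by nlinarith) (le_min (by nlinarith) le_rfl)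

lemma concaveOn_minSq_sub_sq (a b c : ℝ) :
    ConcaveOn ℝ univ (fun x => minSq a b c x - x ^ 2) := by
  have affine (d : ℝ) : ConcaveOn ℝ univ (fun x : ℝ => d ^ 2 - 2 * d * x) :=
    ⟨convex_univ, fun x _ y _ s t _ _ hst => le_of_eq <| by
      simp only [smul_eq_mul]
      linear_combination d ^ 2 * hst⟩
  refine ((affine a).inf ((affine b).inf (affine c))).congr fun x _ => ?_
  simp only [minSq, Pi.inf_apply, ← min_sub_sub_right]
  congr 1
  · ring
  · congr 1 <;> ring

lemma concaveOn_comp_div_add {g : ℝ → ℝ} (hg : ConcaveOn ℝ univ g) (d : ℝ) :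
    ConcaveOn ℝ univ (fun x => g (x / 3 + d)) := by
  refine ⟨convex_univ, fun x _ y _ s t hs ht hst => ?_⟩
  refine (hg.2 (mem_univ (x / 3 + d)) (mem_univ (y / 3 + d)) hs ht hst).trans_eq ?_
  congr 1
  simp only [smul_eq_mul]
  linear_combination d * hst

lemma iInf_sq_eq_minSq {γ : Finset ℝ} {a b c : ℝ} (h : ∀ x, x ∈ γ ↔ x = a ∨ x = b ∨ x = c)
    (x : ℝ) : (⨅ d : γ, (x - (d : ℝ)) ^ 2) = minSq a b c x := by
  have ha : a ∈ γ := (h a).2 (by simp)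
  have hb : b ∈ γ := (h b).2 (by simp)
  have hc : c ∈ γ := (h c).2 (by simp)
  have hbdd : BddBelow (range fun d : γ => (x - (d : ℝ)) ^ 2) :=
    ⟨0, by rintro _ ⟨d, rfl⟩; exact sq_nonneg _⟩
  have : Nonempty γ := ⟨⟨a, ha⟩⟩
  apply le_antisymm
  · exact le_min (ciInf_le hbdd ⟨a, ha⟩) (le_min (ciInf_le hbdd ⟨b, hb⟩) (ciInf_le hbdd ⟨c, hc⟩))
  · refine le_ciInf fun ⟨d, hd⟩ => ?_
    rcases (h d).1 hd with rfl | rfl | rfl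
    · exact min_le_left _ _
    · exact (min_le_right _ _).trans (min_le_left _ _)
    · exact (min_le_right _ _).trans (min_le_right _ _)

lemma exists_sorted_triple {γ : Finset ℝ} (hne : γ.Nonempty) (hcard : γ.card ≤ 3) :
    ∃ a b c : ℝ, a ≤ b ∧ b ≤ c ∧ ∀ x, x ∈ γ ↔ x = a ∨ x = b ∨ x = c := by
  have hpos := hne.card_pos
  obtain ⟨a, b, c, h⟩ : ∃ a b c : ℝ, ∀ x, x ∈ γ ↔ x = a ∨ x = b ∨ x = c := by
    obtain h | h | h : γ.card = 1 ∨ γ.card = 2 ∨ γ.card = 3 := by omega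
    · obtain ⟨a, rfl⟩ := Finset.card_eq_one.1 h
      exact ⟨a, a, a, by simp⟩
    · obtain ⟨a, b, -, rfl⟩ := Finset.card_eq_two.1 h
      exact ⟨a, b, b, by simp⟩
    · obtain ⟨a, b, c, -, -, -, rfl⟩ := Finset.card_eq_three.1 h
      exact ⟨a, b, c, by simp⟩
  rcases le_total a b with hab | hab <;> rcases le_total b c with hbc | hbc <;>
    rcases le_total a c with hac | hac
  · exact ⟨a, b, c, hab, hbc, h⟩
  · exact ⟨a, b, c, hab, hbc, h⟩
  · exact ⟨a, c, b, hac, hbc, fun x => by rw [h]; tauto⟩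
  · exact ⟨c, a, b, hac, hab, fun x => by rw [h]; tauto⟩
  · exact ⟨b, a, c, hab, hac, fun x => by rw [h]; tauto⟩
  · exact ⟨b, c, a, hbc, hac, fun x => by rw [h]; tauto⟩
  · exact ⟨c, b, a, hbc, hab, fun x => by rw [h]; tauto⟩
  · exact ⟨c, b, a, hbc, hab, fun x => by rw [h]; tauto⟩

/-- Three-means bound for the discrete measure carried by the end points of the second-level
intervals of the Cantor set in `[0, 1/2]` and by `2/3`, `5/6`, `1`. -/
lemma discrete_three_means_bound {a b c : ℝ} (hab : a ≤ b) (hbc : b ≤ c) :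
    68 / 135 ≤ 3 * (minSq a b c 0 + minSq a b c (1/18) + minSq a b c (1/9) + minSq a b c (1/6)
      + minSq a b c (1/3) + minSq a b c (7/18) + minSq a b c (4/9) + minSq a b c (1/2))
      + 8 * (minSq a b c (2/3) + minSq a b c (5/6) + minSq a b c 1) := by
  have n1 := minSq_nonneg a b c 0
  have n2 := minSq_nonneg a b c (1/18)
  have n3 := minSq_nonneg a b c (1/9)
  have n4 := minSq_nonneg a b c (1/6)
  have n5 := minSq_nonneg a b c (1/3)
  have n6 := minSq_nonneg a b c (7/18)
  have n7 := minSq_nonneg a b c (4/9)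
  have n8 := minSq_nonneg a b c (1/2)
  have n9 := minSq_nonneg a b c (2/3)
  have n10 := minSq_nonneg a b c (5/6)
  have n11 := minSq_nonneg a b c 1
  have L {x : ℝ} (h : x ≤ (a + b) / 2) := sq_left_le_minSq hab hbc h
  have M {x : ℝ} (h : (a + b) / 2 ≤ x) (h' : x ≤ (b + c) / 2) := sq_middle_le_minSq hab hbc h h'
  have R {x : ℝ} (h : (b + c) / 2 ≤ x) := sq_right_le_minSq hab hbc h
  have hpq : (a + b) / 2 ≤ (b + c) / 2 := by linarith
  generalize (a + b) / 2 = p at *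
  generalize (b + c) / 2 = q at *
  rcases le_total (1/2) p with hp | hp
  · have l1 := L (x := 0) (by linarith)
    have l2 := L (x := 1/18) (by linarith)
    have l3 := L (x := 1/9) (by linarith)
    have l4 := L (x := 1/6) (by linarith)
    have l5 := L (x := 1/3) (by linarith)
    have l6 := L (x := 7/18) (by linarith)
    have l7 := L (x := 4/9) (by linarith)
    have l8 := L (x := 1/2) (by linarith)
    linarith [sq_nonneg (a - 1/4)]
  rcases le_total q (1/2) with hq | hq
  · have r8 := R (x := 1/2) (by linarith)
    have r9 := R (x := 2/3) (by linarith)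
    have r10 := R (x := 5/6) (by linarith)
    have r11 := R (x := 1) (by linarith)
    linarith [sq_nonneg (c - 43/54)]
  have m8 := M (x := 1/2) hp hq
  rcases le_total p (1/6) with hp1 | hp1
  · have m4 := M (x := 1/6) (by linarith) (by linarith)
    have m5 := M (x := 1/3) (by linarith) (by linarith)
    have m6 := M (x := 7/18) (by linarith) (by linarith)
    have m7 := M (x := 4/9) (by linarith) (by linarith)
    rcases le_total q (2/3) with hq1 | hq1
    · have r9 := R (x := 2/3) (by linarith)
      have r10 := R (x := 5/6) (by linarith)
      have r11 := R (x := 1) (by linarith)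
      linarith [sq_nonneg (b - 11/30), sq_nonneg (c - 5/6)]
    · have m9 := M (x := 2/3) (by linarith) (by linarith)
      linarith [sq_nonneg (b - 65/138)]
  have l1 := L (x := 0) (by linarith)
  have l2 := L (x := 1/18) (by linarith)
  have l3 := L (x := 1/9) (by linarith)
  have l4 := L (x := 1/6) (by linarith)
  rcases le_total p (1/3) with hp2 | hp2
  · have m5 := M (x := 1/3) (by linarith) (by linarith)
    have m6 := M (x := 7/18) (by linarith) (by linarith)
    have m7 := M (x := 4/9) (by linarith) (by linarith)
    rcases le_total q (2/3) with hq1 | hq1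
    · have r9 := R (x := 2/3) (by linarith)
      have r10 := R (x := 5/6) (by linarith)
      have r11 := R (x := 1) (by linarith)
      linarith [sq_nonneg (a - 1/12), sq_nonneg (b - 5/12), sq_nonneg (c - 5/6)]
    have m9 := M (x := 2/3) (by linarith) (by linarith)
    rcases le_total q (5/6) with hq2 | hq2
    · have r10 := R (x := 5/6) (by linarith)
      have r11 := R (x := 1) (by linarith)
      linarith [sq_nonneg (a - 1/12), sq_nonneg (b - 31/60), sq_nonneg (c - 11/12)]
    · have m10 := M (x := 5/6) (by linarith) (by linarith)
      linarith [sq_nonneg (b - 17/28)]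
  have l5 := L (x := 1/3) (by linarith)
  rcases le_total q (2/3) with hq1 | hq1
  · have r9 := R (x := 2/3) (by linarith)
    have r10 := R (x := 5/6) (by linarith)
    have r11 := R (x := 1) (by linarith)
    linarith [sq_nonneg (a - 2/15), sq_nonneg (c - 5/6)]
  have m9 := M (x := 2/3) (by linarith) (by linarith)
  rcases le_total p (7/18) with hp3 | hp3
  · have m6 := M (x := 7/18) (by linarith) (by linarith)
    have m7 := M (x := 4/9) (by linarith) (by linarith)
    rcases le_total q (5/6) with hq2 | hq2
    · have r10 := R (x := 5/6) (by linarith)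
      have r11 := R (x := 1) (by linarith)
      linarith [sq_nonneg (a - 2/15), sq_nonneg (b - 28/51), sq_nonneg (c - 11/12)]
    · have m10 := M (x := 5/6) (by linarith) (by linarith)
      linarith [sq_nonneg (b - 16/25)]
  have l6 := L (x := 7/18) (by linarith)
  rcases le_total q (5/6) with hq2 | hq2
  · have r10 := R (x := 5/6) (by linarith)
    have r11 := R (x := 1) (by linarith)
    linarith [sq_nonneg (a - 19/108), sq_nonneg (b - 41/66), sq_nonneg (c - 11/12)]
  · have m10 := M (x := 5/6) (by linarith) (by linarith)
    linarith [sq_nonneg (a - 19/108), sq_nonneg (b - 27/38)]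

/-- Self-similarity of the Cantor distribution on `[0, 1/2]`. -/
def IsCantorSelfSimilar (μ : Measure ℝ) : Prop :=
  μ = (2 : ℝ≥0∞)⁻¹ • μ.map (fun x => x / 3) + (2 : ℝ≥0∞)⁻¹ • μ.map (fun x => x / 3 + 1/3)

lemma IsCantorSelfSimilar.eq_map_add_map {μ : Measure ℝ} (hμ : IsCantorSelfSimilar μ) :
    μ = (2 : ℝ≥0∞)⁻¹ • μ.map (fun x => x / 3) + (2 : ℝ≥0∞)⁻¹ • μ.map (fun x => x / 3 + 1/3) :=
  hμ

lemma measure_far_le_of_selfSimilar {μ : Measure ℝ} (hμ : IsCantorSelfSimilar μ) (s : ℝ) :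
    μ {x | 1/4 + s < |x - 1/4|} ≤ μ {x | 1/4 + 3 * s < |x - 1/4|} := by
  have hm : MeasurableSet {x : ℝ | 1/4 + s < |x - 1/4|} :=
    measurableSet_lt measurable_const (by fun_prop)
  have h₁ : μ ((fun x : ℝ => x / 3) ⁻¹' {x | 1/4 + s < |x - 1/4|})
      ≤ μ {x | 1/4 + 3 * s < |x - 1/4|} := by
    refine measure_mono fun x hx => ?_
    simp only [mem_preimage, mem_ofPred_eq, lt_abs] at hx ⊢
    rcases hx with hx | hx
    · left; linarith
    · right; linarith
  have h₂ : μ ((fun x : ℝ => x / 3 + 1/3) ⁻¹' {x | 1/4 + s < |x - 1/4|})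
      ≤ μ {x | 1/4 + 3 * s < |x - 1/4|} := by
    refine measure_mono fun x hx => ?_
    simp only [mem_preimage, mem_ofPred_eq, lt_abs] at hx ⊢
    rcases hx with hx | hx
    · left; linarith
    · right; linarith
  calc μ {x | 1/4 + s < |x - 1/4|}
      = (2 : ℝ≥0∞)⁻¹ * μ ((fun x : ℝ => x / 3) ⁻¹' {x | 1/4 + s < |x - 1/4|})
        + (2 : ℝ≥0∞)⁻¹ * μ ((fun x : ℝ => x / 3 + 1/3) ⁻¹' {x | 1/4 + s < |x - 1/4|}) := by
        conv_lhs => rw [hμ.eq_map_add_map]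
        rw [Measure.add_apply, Measure.smul_apply, Measure.smul_apply,
          Measure.map_apply (by fun_prop) hm, Measure.map_apply (by fun_prop) hm]
        rfl
    _ ≤ (2 : ℝ≥0∞)⁻¹ * μ {x | 1/4 + 3 * s < |x - 1/4|}
        + (2 : ℝ≥0∞)⁻¹ * μ {x | 1/4 + 3 * s < |x - 1/4|} := by gcongr
    _ = μ {x | 1/4 + 3 * s < |x - 1/4|} := by
        rw [← add_mul, ENNReal.inv_two_add_inv_two, one_mul]

section SelfSimilar

variable {μ : Measure ℝ} [IsProbabilityMeasure μ]

lemma measure_far_eq_zero_of_selfSimilar (hμ : IsCantorSelfSimilar μ) {s : ℝ} (hs : 0 < s) :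
    μ {x | 1/4 + s < |x - 1/4|} = 0 := by
  have hle (k : ℕ) : μ {x | 1/4 + s < |x - 1/4|} ≤ μ {x | 1/4 + 3 ^ k * s < |x - 1/4|} := by
    induction k with
    | zero => simp
    | succ k ih =>
      refine ih.trans ((measure_far_le_of_selfSimilar hμ _).trans_eq ?_)
      ring_nf
  have hlim : Tendsto (fun k : ℕ => μ {x | 1/4 + 3 ^ k * s < |x - 1/4|}) atTop
      (nhds (μ (⋂ k : ℕ, {x | 1/4 + 3 ^ k * s < |x - 1/4|}))) := by
    refine tendsto_measure_iInter_atTop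
      (fun k => (measurableSet_lt measurable_const (by fun_prop)).nullMeasurableSet)
      (fun i j hij x hx => ?_) ⟨0, measure_ne_top _ _⟩
    simp only [mem_ofPred_eq] at hx ⊢
    have : (3 : ℝ) ^ i * s ≤ 3 ^ j * s := by gcongr; norm_num
    linarith
  have hempty : (⋂ k : ℕ, {x : ℝ | 1/4 + 3 ^ k * s < |x - 1/4|}) = ∅ := by
    refine eq_empty_of_forall_notMem fun x hx => ?_
    obtain ⟨k, hk⟩ := pow_unbounded_of_one_lt (|x - 1/4| / s) (by norm_num : (1 : ℝ) < 3)
    rw [div_lt_iff₀ hs] at hk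
    have := mem_iInter.1 hx k
    simp only [mem_ofPred_eq] at this
    linarith
  rw [hempty, measure_empty] at hlim
  exact le_antisymm (ge_of_tendsto' hlim hle) zero_le

lemma ae_mem_Icc_of_selfSimilar (hμ : IsCantorSelfSimilar μ) :
    ∀ᵐ x ∂μ, x ∈ Icc (0 : ℝ) (1/2) := by
  have h : ∀ᵐ x ∂μ, ∀ n : ℕ, ¬ 1/4 + 1 / ((n : ℝ) + 1) < |x - 1/4| := by
    rw [ae_all_iff]
    intro n
    rw [ae_iff]
    simpa only [not_not] using
      measure_far_eq_zero_of_selfSimilar hμ (Nat.one_div_pos_of_nat (α := ℝ) (n := n))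
  filter_upwards [h] with x hx
  have hx' : |x - 1/4| ≤ 1/4 := by
    by_contra! hlt
    obtain ⟨n, hn⟩ := exists_nat_one_div_lt (sub_pos.2 hlt)
    exact hx n (by linarith)
  rw [abs_le] at hx'
  constructor <;> linarith

lemma integrable_of_selfSimilar (hμ : IsCantorSelfSimilar μ) {f : ℝ → ℝ} (hf : Continuous f) :
    Integrable f μ := by
  have h := hf.continuousOn.integrableOn_compact (μ := μ) (isCompact_Icc (a := (0 : ℝ)) (b := 1/2))
  rwa [IntegrableOn, Measure.restrict_eq_self_of_ae_mem (ae_mem_Icc_of_selfSimilar hμ)] at h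

lemma integral_of_selfSimilar (hμ : IsCantorSelfSimilar μ) {f : ℝ → ℝ} (hf : Continuous f) :
    ∫ x, f x ∂μ = ((∫ x, f (x / 3) ∂μ) + ∫ x, f (x / 3 + 1/3) ∂μ) / 2 := by
  have h := integrable_of_selfSimilar hμ hf
  rw [hμ.eq_map_add_map, integrable_add_measure] at h
  conv_lhs => rw [hμ.eq_map_add_map]
  rw [integral_add_measure h.1 h.2, integral_smul_measure, integral_smul_measure,
    integral_map (by fun_prop) hf.aestronglyMeasurable,
    integral_map (by fun_prop) hf.aestronglyMeasurable]
  simp only [ENNReal.toReal_inv, ENNReal.toReal_ofNat, smul_eq_mul]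
  ring

lemma integral_quadratic_eq_moments (hμ : IsCantorSelfSimilar μ) (r s t : ℝ) :
    ∫ x, (r * x ^ 2 + s * x + t) ∂μ = r * (∫ x, x ^ 2 ∂μ) + s * (∫ x, x ∂μ) + t := by
  rw [integral_add (integrable_of_selfSimilar hμ (by fun_prop))
      (integrable_of_selfSimilar hμ (by fun_prop)),
    integral_add (integrable_of_selfSimilar hμ (by fun_prop))
      (integrable_of_selfSimilar hμ (by fun_prop)), integral_const_mul, integral_const_mul]
  simp

lemma integral_quadratic_of_selfSimilar (hμ : IsCantorSelfSimilar μ) (r s t : ℝ) :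
    ∫ x, (r * x ^ 2 + s * x + t) ∂μ = r * (3/32) + s * (1/4) + t := by
  have h₁ : ∫ x, x ∂μ = 1/4 := by
    have h := integral_of_selfSimilar hμ (f := fun x => x) (by fun_prop)
    have e₁ := integral_quadratic_eq_moments hμ 0 (1/3) 0
    have e₂ := integral_quadratic_eq_moments hμ 0 (1/3) (1/3)
    ring_nf at h e₁ e₂ ⊢
    linarith
  have h₂ : ∫ x, x ^ 2 ∂μ = 3/32 := by
    have h := integral_of_selfSimilar hμ (f := fun x => x ^ 2) (by fun_prop)
    have e₁ := integral_quadratic_eq_moments hμ (1/9) 0 0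
    have e₂ := integral_quadratic_eq_moments hμ (1/9) (2/9) (1/9)
    ring_nf at h e₁ e₂ h₁ ⊢
    linarith
  rw [integral_quadratic_eq_moments hμ, h₁, h₂]

lemma le_integral_of_concaveOn (hμ : IsCantorSelfSimilar μ) {g : ℝ → ℝ}
    (hg : ConcaveOn ℝ univ g) (hc : Continuous g) :
    (g 0 + g (1/2)) / 2 ≤ ∫ x, g x ∂μ := by
  have h := integral_quadratic_of_selfSimilar hμ 0 (2 * (g (1/2) - g 0)) (g 0)
  calc (g 0 + g (1/2)) / 2
      = ∫ x, (0 * x ^ 2 + 2 * (g (1/2) - g 0) * x + g 0) ∂μ := by rw [h]; ring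
    _ ≤ ∫ x, g x ∂μ := by
      refine integral_mono_ae (integrable_of_selfSimilar hμ (by fun_prop))
        (integrable_of_selfSimilar hμ hc) ?_
      filter_upwards [ae_mem_Icc_of_selfSimilar hμ] with x ⟨hx₀, hx₁⟩
      have := hg.2 (mem_univ 0) (mem_univ (1/2)) (by linarith : 0 ≤ 1 - 2 * x)
        (by linarith : 0 ≤ 2 * x) (by ring)
      simp only [smul_eq_mul] at this
      ring_nf at this ⊢
      linarith

lemma le_integral_of_concaveOn_refined (hμ : IsCantorSelfSimilar μ) {g : ℝ → ℝ}
    (hg : ConcaveOn ℝ univ g) (hc : Continuous g) :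
    (g 0 + g (1/18) + g (1/9) + g (1/6) + g (1/3) + g (7/18) + g (4/9) + g (1/2)) / 8
      ≤ ∫ x, g x ∂μ := by
  have refine_once {g : ℝ → ℝ} (hg : ConcaveOn ℝ univ g) (hc : Continuous g) :
      (g 0 + g (1/6) + g (1/3) + g (1/2)) / 4 ≤ ∫ x, g x ∂μ := by
    have h := integral_of_selfSimilar hμ hc
    have h₁ := le_integral_of_concaveOn hμ (concaveOn_comp_div_add hg 0) (by fun_prop)
    have h₂ := le_integral_of_concaveOn hμ (concaveOn_comp_div_add hg (1/3)) (by fun_prop)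
    norm_num at h h₁ h₂ ⊢
    linarith
  have h := integral_of_selfSimilar hμ hc
  have h₁ := refine_once (concaveOn_comp_div_add hg 0) (by fun_prop)
  have h₂ := refine_once (concaveOn_comp_div_add hg (1/3)) (by fun_prop)
  norm_num at h h₁ h₂ ⊢
  linarith

end SelfSimilar

lemma integral_mix_discD {μ : Measure ℝ} {f : ℝ → ℝ} (hf : Integrable f μ) :
    ∫ x, f x ∂(mix μ discD) = (∫ x, f x ∂μ) / 2 + (f (2/3) + f (5/6) + f 1) / 6 := by
  have hd (x : ℝ) : Integrable f (Measure.dirac x) := integrable_dirac (by simp)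
  have h₁₂ := (hd (2/3)).add_measure (hd (5/6))
  have hD : Integrable f discD := (h₁₂.add_measure (hd 1)).smul_measure (by simp)
  rw [mix, integral_add_measure (hf.smul_measure (by simp)) (hD.smul_measure (by simp)),
    integral_smul_measure, integral_smul_measure, discD, integral_smul_measure,
    integral_add_measure h₁₂ (hd 1), integral_add_measure (hd _) (hd _),
    integral_dirac, integral_dirac, integral_dirac]
  simp only [ENNReal.toReal_inv, ENNReal.toReal_ofNat, smul_eq_mul]
  ring

section Distortion

variable {μ : Measure ℝ} [IsProbabilityMeasure μ]

lemma distortion_mix_eq (hμ : IsCantorSelfSimilar μ) {γ : Finset ℝ} {a b c : ℝ}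
    (h : ∀ x, x ∈ γ ↔ x = a ∨ x = b ∨ x = c) :
    distortion (mix μ discD) γ = (∫ x, minSq a b c x ∂μ) / 2
      + (minSq a b c (2/3) + minSq a b c (5/6) + minSq a b c 1) / 6 := by
  simp only [distortion, iInf_sq_eq_minSq h]
  exact integral_mix_discD (integrable_of_selfSimilar hμ (continuous_minSq a b c))

lemma le_distortion_mix (hμ : IsCantorSelfSimilar μ) {γ : Finset ℝ} (hne : γ.Nonempty)
    (hcard : γ.card ≤ 3) :
    89/8640 ≤ distortion (mix μ discD) γ := by
  obtain ⟨a, b, c, hab, hbc, h⟩ := exists_sorted_triple hne hcard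
  rw [distortion_mix_eq hμ h]
  have hcont := continuous_minSq a b c
  have hg := le_integral_of_concaveOn_refined hμ (concaveOn_minSq_sub_sq a b c) (by fun_prop)
  have hsub : ∫ x, (minSq a b c x - x ^ 2) ∂μ = (∫ x, minSq a b c x ∂μ) - 3/32 := by
    rw [integral_sub (integrable_of_selfSimilar hμ hcont)
      (integrable_of_selfSimilar hμ (by fun_prop))]
    have := integral_quadratic_of_selfSimilar hμ 1 0 0
    norm_num at this
    rw [this]
  rw [hsub] at hg
  have := discrete_three_means_bound hab hbc
  norm_num at hg this ⊢
  linarith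

lemma distortion_mix_le (hμ : IsCantorSelfSimilar μ) :
    distortion (mix μ discD) ({1/12, 31/60, 11/12} : Finset ℝ) ≤ 89/8640 := by
  have hcont := continuous_minSq (1/12) (31/60) (11/12)
  rw [distortion_mix_eq hμ (a := 1/12) (b := 31/60) (c := 11/12) (by simp),
    integral_of_selfSimilar hμ hcont]
  have h₁ : ∫ x, minSq (1/12) (31/60) (11/12) (x / 3) ∂μ
      ≤ ∫ x, (1/9 * x ^ 2 + (-1/18) * x + 1/144) ∂μ := by
    refine integral_mono (integrable_of_selfSimilar hμ (by fun_prop))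
      (integrable_of_selfSimilar hμ (by fun_prop)) fun x => ?_
    refine (min_le_left _ _).trans_eq ?_
    ring
  have h₂ : ∫ x, minSq (1/12) (31/60) (11/12) (x / 3 + 1/3) ∂μ
      ≤ ∫ x, (1/9 * x ^ 2 + (-11/90) * x + 121/3600) ∂μ := by
    refine integral_mono (integrable_of_selfSimilar hμ (by fun_prop))
      (integrable_of_selfSimilar hμ (by fun_prop)) fun x => ?_
    refine ((min_le_right _ _).trans (min_le_left _ _)).trans_eq ?_
    ring
  have h₃ : minSq (1/12) (31/60) (11/12) (2/3) ≤ (2/3 - 31/60) ^ 2 :=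
    (min_le_right _ _).trans (min_le_left _ _)
  have h₄ : minSq (1/12) (31/60) (11/12) (5/6) ≤ (5/6 - 11/12) ^ 2 :=
    (min_le_right _ _).trans (min_le_right _ _)
  have h₅ : minSq (1/12) (31/60) (11/12) 1 ≤ (1 - 11/12) ^ 2 :=
    (min_le_right _ _).trans (min_le_right _ _)
  rw [integral_quadratic_of_selfSimilar hμ] at h₁ h₂
  linarith

end Distortion


theorem stmt12 (P₁ : Measure ℝ) [IsProbabilityMeasure P₁]
    (hP₁ : P₁ = (2 : ℝ≥0∞)⁻¹ • P₁.map (fun x => x / 3) +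
      (2 : ℝ≥0∞)⁻¹ • P₁.map (fun x => x / 3 + 1/3))
    (P : Measure ℝ) (hP : P = mix P₁ discD) :
    IsOptimalSet P 3 ({1/12, 31/60, 11/12} : Finset ℝ) ∧ quantErr P 3 = 89/8640 := by
  subst hP
  have hle {γ : Finset ℝ} (hne : γ.Nonempty) (hcard : γ.card ≤ 3) :=
    le_distortion_mix hP₁ hne hcard
  have hne : ({1/12, 31/60, 11/12} : Finset ℝ).Nonempty := by simp
  have hcard : ({1/12, 31/60, 11/12} : Finset ℝ).card ≤ 3 := Finset.card_le_three
  have heq := (distortion_mix_le hP₁).antisymm (hle hne hcard)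
  have hV : quantErr (mix P₁ discD) 3 = 89/8640 := by
    refine IsLeast.csInf_eq ⟨⟨_, hne, hcard, heq.symm⟩, ?_⟩
    rintro _ ⟨γ, hγ, hγ', rfl⟩
    exact hle hγ hγ'
  exact ⟨⟨hne, hcard, heq.trans hV.symm⟩, hV⟩
end

section
/- Let P₁, P₂ be the self-similar measures with P₁ = (1/2)P₁∘S₁⁻¹ + (1/2)P₁∘S₂⁻¹ (S₁(x)=x/3, S₂(x)=x/3+2/9, support in [0,1/3]) and P₂ = (1/2)P₂∘T₁⁻¹ + (1/2)P₂∘T₂⁻¹ (T₁(x)=x/4+1/2, T₂(x)=x/4+3/4, support in [2/3,1]), and let P = (1/2)P₁ + (1/2)P₂. For every n ≥ 2, every optimal set of n-means for P contains at least one point of [0,1/3) and at least one point of (2/3,1], and contains no point of the open interval (1/3, 2/3). -/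
open MeasureTheory Set Filter Real
open scoped ENNReal

section Quantizer

variable {γ : Finset ℝ}

lemma iInf_sq_le {c : ℝ} (hc : c ∈ γ) (x : ℝ) :
    (⨅ d : γ, (x - (d : ℝ)) ^ 2) ≤ (x - c) ^ 2 :=
  ciInf_le (f := fun d : γ => (x - (d : ℝ)) ^ 2)
    ⟨0, by rintro _ ⟨d, rfl⟩; exact sq_nonneg _⟩ ⟨c, hc⟩

lemma iInf_sq_nonneg (γ : Finset ℝ) (x : ℝ) : 0 ≤ ⨅ d : γ, (x - (d : ℝ)) ^ 2 :=
  Real.iInf_nonneg fun _ => sq_nonneg _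

lemma exists_iInf_sq_eq (hγ : γ.Nonempty) (x : ℝ) :
    ∃ c ∈ γ, (⨅ d : γ, (x - (d : ℝ)) ^ 2) = (x - c) ^ 2 := by
  have := hγ.to_subtype
  obtain ⟨d, hd⟩ := exists_eq_ciInf_of_finite (f := fun d : γ => (x - (d : ℝ)) ^ 2)
  exact ⟨d, d.2, hd.symm⟩

lemma le_iInf_sq (hγ : γ.Nonempty) {x v : ℝ} (h : ∀ d ∈ γ, v ≤ (x - d) ^ 2) :
    v ≤ ⨅ d : γ, (x - (d : ℝ)) ^ 2 := by
  obtain ⟨c, hc, h'⟩ := exists_iInf_sq_eq hγ x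
  exact h' ▸ h c hc

lemma continuous_iInf_sq (hγ : γ.Nonempty) :
    Continuous fun x : ℝ => ⨅ d : γ, (x - (d : ℝ)) ^ 2 := by
  have := hγ.to_subtype
  simp_rw [← Finset.inf'_univ_eq_ciInf]
  exact Continuous.finset_inf'_apply _ fun d _ => by fun_prop

end Quantizer

lemma quantErr_le_distortion {P : Measure ℝ} {n : ℕ} {γ : Finset ℝ} (hγ : γ.Nonempty)
    (hn : γ.card ≤ n) : quantErr P n ≤ distortion P γ :=
  csInf_le ⟨0, by
    rintro _ ⟨δ, -, -, rfl⟩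
    exact integral_nonneg fun x => iInf_sq_nonneg δ x⟩ ⟨γ, hγ, hn, rfl⟩

section SelfSimilar

variable {μ : Measure ℝ} {f g : ℝ → ℝ}

lemma map_mem_support (hf : Continuous f) (h : (2 : ℝ≥0∞)⁻¹ • μ.map f ≤ μ) {t : ℝ}
    (ht : t ∈ μ.support) : f t ∈ μ.support := by
  rw [Measure.mem_support_iff_forall] at ht ⊢
  intro U hU
  have h1 : 0 < μ (f ⁻¹' U) := ht _ (hf.continuousAt hU)
  have h2 : μ (f ⁻¹' U) ≤ μ.map f U := Measure.le_map_apply hf.aemeasurable U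
  have h3 : (2 : ℝ≥0∞)⁻¹ * μ.map f U ≤ μ U := by simpa using h U
  refine lt_of_lt_of_le (ENNReal.mul_pos (by simp) (h1.trans_le h2).ne') h3

lemma fixedPoint_mem_support [NeZero μ] (hf : Continuous f) (h : (2 : ℝ≥0∞)⁻¹ • μ.map f ≤ μ)
    {z r : ℝ} (hr : 0 ≤ r) (hr1 : r < 1) (hz : ∀ x, f x - z = r * (x - z)) :
    z ∈ μ.support := by
  obtain ⟨t, ht⟩ := Measure.nonempty_support (NeZero.ne μ)
  have hk : ∀ k : ℕ, f^[k] t ∈ μ.support ∧ |f^[k] t - z| ≤ r ^ k * |t - z| := by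
    intro k
    induction k with
    | zero => simpa using ht
    | succ k ih =>
      rw [Function.iterate_succ_apply']
      refine ⟨map_mem_support hf h ih.1, ?_⟩
      rw [hz, abs_mul, abs_of_nonneg hr, pow_succ', mul_assoc]
      exact mul_le_mul_of_nonneg_left ih.2 hr
  refine Measure.isClosed_support.mem_of_tendsto (f := fun k => f^[k] t) (b := atTop) ?_
    (Eventually.of_forall fun k => (hk k).1)
  rw [tendsto_iff_norm_sub_tendsto_zero]
  refine squeeze_zero (fun _ => norm_nonneg _) (fun k => (hk k).2) ?_
  simpa using (tendsto_pow_atTop_nhds_zero_of_lt_one hr hr1).mul_const |t - z|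

lemma ae_nonpos_of_selfSimilar [IsFiniteMeasure μ] (hf : Measurable f) (hg : Measurable g)
    (h : μ = (2 : ℝ≥0∞)⁻¹ • μ.map f + (2 : ℝ≥0∞)⁻¹ • μ.map g) {v : ℝ → ℝ} (hv : Measurable v)
    (hvf : ∀ x, 0 < v (f x) → 2 * v (f x) ≤ v x) (hvg : ∀ x, 0 < v (g x) → 2 * v (g x) ≤ v x) :
    ∀ᵐ x ∂μ, v x ≤ 0 := by
  have hm : ∀ R : ℝ, MeasurableSet {x | R < v x} := fun R => measurableSet_lt measurable_const hv
  have step : ∀ R : ℝ, 0 < R → μ {x | R < v x} ≤ μ {x | 2 * R < v x} := by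
    intro R hR
    have hf' : μ (f ⁻¹' {x | R < v x}) ≤ μ {x | 2 * R < v x} :=
      measure_mono fun x (hx : R < v (f x)) => show 2 * R < v x by linarith [hvf x (hR.trans hx)]
    have hg' : μ (g ⁻¹' {x | R < v x}) ≤ μ {x | 2 * R < v x} :=
      measure_mono fun x (hx : R < v (g x)) => show 2 * R < v x by linarith [hvg x (hR.trans hx)]
    calc μ {x | R < v x}
        = (2 : ℝ≥0∞)⁻¹ * μ (f ⁻¹' {x | R < v x}) + (2 : ℝ≥0∞)⁻¹ * μ (g ⁻¹' {x | R < v x}) := by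
          conv_lhs => rw [h]
          simp [Measure.map_apply hf (hm R), Measure.map_apply hg (hm R)]
      _ ≤ (2 : ℝ≥0∞)⁻¹ * μ {x | 2 * R < v x} + (2 : ℝ≥0∞)⁻¹ * μ {x | 2 * R < v x} := by gcongr
      _ = μ {x | 2 * R < v x} := by
          rw [← add_mul, ENNReal.inv_two_add_inv_two, one_mul]
  have iter : ∀ (k : ℕ) (R : ℝ), 0 < R → μ {x | R < v x} ≤ μ {x | 2 ^ k * R < v x} := by
    intro k
    induction k with
    | zero => intro R _; simp
    | succ k ih =>
      intro R hR
      refine (ih R hR).trans ((step _ (by positivity)).trans_eq ?_)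
      rw [pow_succ', mul_assoc]
  have lim : Tendsto (fun k : ℕ => μ {x | (k : ℝ) < v x}) atTop (nhds 0) := by
    have := tendsto_measure_iInter_atTop (μ := μ) (s := fun k : ℕ => {x | (k : ℝ) < v x})
      (fun k => (hm k).nullMeasurableSet)
      (fun i j hij x (hx : (j : ℝ) < v x) =>
        show (i : ℝ) < v x from lt_of_le_of_lt (by exact_mod_cast hij) hx)
      ⟨0, measure_ne_top _ _⟩
    have he : (⋂ k : ℕ, {x | (k : ℝ) < v x}) = ∅ := by
      ext x
      simp only [mem_iInter, mem_ofPred_eq, mem_empty_iff_false, iff_false, not_forall, not_lt]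
      exact exists_nat_ge (v x)
    simpa [he, Function.comp_def] using this
  have null : ∀ R : ℝ, 0 < R → μ {x | R < v x} = 0 := by
    intro R hR
    refine le_antisymm (ge_of_tendsto' lim fun m => ?_) zero_le
    obtain ⟨k, hk⟩ := pow_unbounded_of_one_lt ((m : ℝ) / R) one_lt_two
    refine (iter k R hR).trans (measure_mono fun x (hx : 2 ^ k * R < v x) => ?_)
    exact ((div_lt_iff₀ hR).1 hk).trans hx
  rw [ae_iff]
  refine measure_mono_null (t := ⋃ k : ℕ, {x | 1 / ((k : ℝ) + 1) < v x}) (fun x hx => ?_)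
    (measure_iUnion_null fun k => null _ (by positivity))
  obtain ⟨k, hk⟩ := exists_nat_one_div_lt (not_le.1 hx)
  exact mem_iUnion.2 ⟨k, hk⟩

lemma integrable_of_ae_mem_Icc [IsFiniteMeasure μ] {a b : ℝ} (h : ∀ᵐ x ∂μ, x ∈ Icc a b)
    {F : ℝ → ℝ} (hF : Continuous F) : Integrable F μ := by
  obtain ⟨C, hC⟩ := isCompact_Icc.exists_bound_of_continuousOn (s := Icc a b) hF.continuousOn
  exact .of_bound hF.aestronglyMeasurable C (h.mono fun x hx => hC x hx)

lemma integral_selfSimilar (hf : Continuous f) (hg : Continuous g)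
    (h : μ = (2 : ℝ≥0∞)⁻¹ • μ.map f + (2 : ℝ≥0∞)⁻¹ • μ.map g)
    (hFint : ∀ F : ℝ → ℝ, Continuous F → Integrable F μ)
    {F : ℝ → ℝ} (hF : Continuous F) :
    ∫ x, F x ∂μ = (1 / 2) * ∫ x, F (f x) ∂μ + (1 / 2) * ∫ x, F (g x) ∂μ := by
  have key : ∀ k : ℝ → ℝ, Continuous k →
      Integrable F (μ.map k) ∧ ∫ x, F x ∂(μ.map k) = ∫ x, F (k x) ∂μ := fun k hk =>
    ⟨(integrable_map_measure hF.aestronglyMeasurable hk.aemeasurable).2 (hFint _ (hF.comp hk)),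
      integral_map hk.aemeasurable hF.aestronglyMeasurable⟩
  conv_lhs => rw [h]
  rw [integral_add_measure ((key f hf).1.smul_measure (by simp))
    ((key g hg).1.smul_measure (by simp)), integral_smul_measure, integral_smul_measure,
    (key f hf).2, (key g hg).2]
  simp

end SelfSimilar

section Optimal

variable {P : Measure ℝ} {n : ℕ} {γ δ : Finset ℝ}

lemma IsOptimalSet.mem_of_ae_le (hFint : ∀ F : ℝ → ℝ, Continuous F → Integrable F P)
    (hγ : IsOptimalSet P n γ) (hδ : δ.card ≤ n) {t : ℝ} (ht : t ∈ P.support) (htδ : t ∈ δ)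
    (hle : ∀ᵐ x ∂P, (⨅ d : δ, (x - (d : ℝ)) ^ 2) ≤ ⨅ d : γ, (x - (d : ℝ)) ^ 2) :
    t ∈ γ := by
  have hδ0 : δ.Nonempty := ⟨t, htδ⟩
  have cγ := continuous_iInf_sq hγ.1
  have cδ := continuous_iInf_sq hδ0
  have hopt : distortion P γ ≤ distortion P δ := hγ.2.2.trans_le (quantErr_le_distortion hδ0 hδ)
  have hae := (integral_eq_iff_of_ae_le (hFint _ cδ) (hFint _ cγ) hle).1
    (le_antisymm (integral_mono_ae (hFint _ cδ) (hFint _ cγ) hle) hopt)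
  by_contra htγ
  have hne : (⨅ d : δ, (t - (d : ℝ)) ^ 2) ≠ ⨅ d : γ, (t - (d : ℝ)) ^ 2 := by
    obtain ⟨c, hc, hc'⟩ := exists_iInf_sq_eq hγ.1 t
    have h0 : 0 < (t - c) ^ 2 := by
      have : t - c ≠ 0 := sub_ne_zero.2 fun h => htγ (h ▸ hc)
      positivity
    have h1 := iInf_sq_le htδ t
    rw [hc']
    intro h
    rw [h] at h1
    simp only [sub_self] at h1
    linarith
  have hopen := isOpen_ne_fun cδ cγ
  exact (((Measure.mem_support_iff_forall t).1 ht _ (hopen.mem_nhds hne)).ne') hae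

lemma IsOptimalSet.not_ae_dominated (hFint : ∀ F : ℝ → ℝ, Continuous F → Integrable F P)
    (hinf : P.support.Infinite) (hγ : IsOptimalSet P n γ) {c : ℝ} (hc : c ∈ γ) :
    ¬ ∀ᵐ x ∂P, ∃ d ∈ γ, d ≠ c ∧ (x - d) ^ 2 ≤ (x - c) ^ 2 := by
  intro h
  obtain ⟨t, ht, htγ⟩ := hinf.exists_notMem_finset γ
  refine htγ (hγ.mem_of_ae_le hFint (δ := insert t (γ.erase c)) ?_ ht
    (Finset.mem_insert_self _ _) ?_)
  · exact (Finset.card_insert_le _ _).trans ((Finset.card_erase_add_one hc).trans_le hγ.2.1)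
  · filter_upwards [h] with x hx
    obtain ⟨e, he, heq⟩ := exists_iInf_sq_eq hγ.1 x
    rw [heq]
    obtain ⟨d, hd, hdc, hle⟩ := hx
    by_cases hec : e = c
    · subst hec
      exact (iInf_sq_le (by simp [hd, hdc]) x).trans hle
    · exact iInf_sq_le (by simp [he, hec]) x

lemma IsOptimalSet.not_ae_dominated_insert
    (hFint : ∀ F : ℝ → ℝ, Continuous F → Integrable F P)
    (hinf : P.support.Infinite) (hγ : IsOptimalSet P n γ) {c z : ℝ} (hc : c ∈ γ)
    (hz : z ∈ P.support) (hzc : z ≠ c) :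
    ¬ ∀ᵐ x ∂P, (∃ d ∈ γ, d ≠ c ∧ (x - d) ^ 2 ≤ (x - c) ^ 2) ∨ (x - z) ^ 2 ≤ (x - c) ^ 2 := by
  intro h
  have hzγ : z ∈ γ := by
    refine hγ.mem_of_ae_le hFint (δ := insert z (γ.erase c)) ?_ hz (Finset.mem_insert_self _ _) ?_
    · exact (Finset.card_insert_le _ _).trans ((Finset.card_erase_add_one hc).trans_le hγ.2.1)
    · filter_upwards [h] with x hx
      obtain ⟨e, he, heq⟩ := exists_iInf_sq_eq hγ.1 x
      rw [heq]
      by_cases hec : e = c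
      · subst hec
        rcases hx with ⟨d, hd, hdc, hle⟩ | hle
        · exact (iInf_sq_le (by simp [hd, hdc]) x).trans hle
        · exact (iInf_sq_le (by simp) x).trans hle
      · exact iInf_sq_le (by simp [he, hec]) x
  refine hγ.not_ae_dominated hFint hinf hc (h.mono fun x hx => ?_)
  rcases hx with hx | hx
  · exact hx
  · exact ⟨z, hzγ, hzc, hx⟩

end Optimal

section Moments

variable {μ : Measure ℝ} [IsProbabilityMeasure μ] {a b m V : ℝ}

lemma integral_centered_quadratic (h : ∀ᵐ x ∂μ, x ∈ Icc a b) (hm : ∫ x, x ∂μ = m)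
    (hV : ∫ x, (x - m) ^ 2 ∂μ = V) (A B C : ℝ) :
    ∫ x, (A * (x - m) ^ 2 + B * (x - m) + C) ∂μ = A * V + C := by
  have hi : ∀ F : ℝ → ℝ, Continuous F → Integrable F μ := fun F => integrable_of_ae_mem_Icc h
  rw [integral_add (hi _ (by fun_prop)) (hi _ (by fun_prop)),
    integral_add (hi _ (by fun_prop)) (hi _ (by fun_prop)), integral_const_mul,
    integral_const_mul, integral_sub (hi _ (by fun_prop)) (hi _ (by fun_prop)), hV, hm]
  simp

lemma le_integral_of_quadratic_le (h : ∀ᵐ x ∂μ, x ∈ Icc a b) (hm : ∫ x, x ∂μ = m)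
    (hV : ∫ x, (x - m) ^ 2 ∂μ = V) {F : ℝ → ℝ} (hF : Continuous F) (A B C : ℝ)
    (hle : ∀ x ∈ Icc a b, A * (x - m) ^ 2 + B * (x - m) + C ≤ F x) :
    A * V + C ≤ ∫ x, F x ∂μ := by
  rw [← integral_centered_quadratic h hm hV A B C]
  exact integral_mono_ae (integrable_of_ae_mem_Icc h (by fun_prop))
    (integrable_of_ae_mem_Icc h hF) (h.mono hle)

lemma integral_le_of_le_quadratic (h : ∀ᵐ x ∂μ, x ∈ Icc a b) (hm : ∫ x, x ∂μ = m)
    (hV : ∫ x, (x - m) ^ 2 ∂μ = V) {F : ℝ → ℝ} (hF : Continuous F) (A B C : ℝ)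
    (hle : ∀ x ∈ Icc a b, F x ≤ A * (x - m) ^ 2 + B * (x - m) + C) :
    ∫ x, F x ∂μ ≤ A * V + C := by
  rw [← integral_centered_quadratic h hm hV A B C]
  exact integral_mono_ae (integrable_of_ae_mem_Icc h hF)
    (integrable_of_ae_mem_Icc h (by fun_prop)) (h.mono hle)

end Moments

/-- Self-similarity of `μ` under `x ↦ x / 3` and `x ↦ x / 3 + 2/9` with equal weights. -/
abbrev IsCantorLeft (μ : Measure ℝ) : Prop :=
  μ = (2 : ℝ≥0∞)⁻¹ • μ.map (fun x => x / 3) + (2 : ℝ≥0∞)⁻¹ • μ.map (fun x => x / 3 + 2/9)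

/-- Self-similarity of `μ` under `x ↦ x / 4 + 1/2` and `x ↦ x / 4 + 3/4` with equal weights. -/
abbrev IsCantorRight (μ : Measure ℝ) : Prop :=
  μ = (2 : ℝ≥0∞)⁻¹ • μ.map (fun x => x / 4 + 1/2) + (2 : ℝ≥0∞)⁻¹ • μ.map (fun x => x / 4 + 3/4)

section Left

variable {μ : Measure ℝ} [IsProbabilityMeasure μ]

lemma ae_mem_Icc_left (hμ : IsCantorLeft μ) : ∀ᵐ x ∂μ, x ∈ Icc (0 : ℝ) (1/3) := by
  have h1 := ae_nonpos_of_selfSimilar (v := fun x => -x) (by fun_prop)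
    (by fun_prop) hμ (by fun_prop) (fun x h => by linarith)
    (fun x h => by linarith)
  have h2 := ae_nonpos_of_selfSimilar (v := fun x => x - 1/3) (by fun_prop)
    (by fun_prop) hμ (by fun_prop) (fun x h => by linarith)
    (fun x h => by linarith)
  filter_upwards [h1, h2] with x hx hx'
  constructor <;> linarith

lemma integral_left (hμ : IsCantorLeft μ) {F : ℝ → ℝ} (hF : Continuous F) :
    ∫ x, F x ∂μ = (1 / 2) * ∫ x, F (x / 3) ∂μ + (1 / 2) * ∫ x, F (x / 3 + 2/9) ∂μ :=
  integral_selfSimilar (by fun_prop) (by fun_prop) hμ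
    (fun _ => integrable_of_ae_mem_Icc (ae_mem_Icc_left hμ)) hF

lemma integral_id_left (hμ : IsCantorLeft μ) : ∫ x, x ∂μ = 1/6 := by
  have h := integral_left hμ (F := fun x => x) (by fun_prop)
  rw [integral_add (integrable_of_ae_mem_Icc (ae_mem_Icc_left hμ) (by fun_prop)) (by fun_prop),
    integral_div] at h
  simp at h
  linarith

lemma integral_sq_left (hμ : IsCantorLeft μ) : ∫ x, (x - 1/6) ^ 2 ∂μ = 1/72 := by
  have h := integral_left hμ (F := fun x => (x - 1/6) ^ 2) (by fun_prop)
  have q := integral_centered_quadratic (ae_mem_Icc_left hμ) (integral_id_left hμ) rfl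
  have e1 := q (1/9) (-2/27) (1/81)
  have e2 := q (1/9) (2/27) (1/81)
  have f1 : ∀ x : ℝ, (x / 3 - 1/6) ^ 2 = 1/9 * (x - 1/6) ^ 2 + -2/27 * (x - 1/6) + 1/81 :=
    fun x => by ring
  have f2 : ∀ x : ℝ, (x / 3 + 2/9 - 1/6) ^ 2 = 1/9 * (x - 1/6) ^ 2 + 2/27 * (x - 1/6) + 1/81 :=
    fun x => by ring
  simp_rw [f1, f2] at h
  rw [e1, e2] at h
  linarith

lemma le_integral_left (hμ : IsCantorLeft μ) {F : ℝ → ℝ} (hF : Continuous F) (A B C : ℝ)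
    (h : ∀ x ∈ Icc (0 : ℝ) (1/3), A * (x - 1/6) ^ 2 + B * (x - 1/6) + C ≤ F x) :
    A * (1/72) + C ≤ ∫ x, F x ∂μ :=
  le_integral_of_quadratic_le (ae_mem_Icc_left hμ) (integral_id_left hμ) (integral_sq_left hμ)
    hF A B C h

lemma integral_left_le (hμ : IsCantorLeft μ) {F : ℝ → ℝ} (hF : Continuous F) (A B C : ℝ)
    (h : ∀ x ∈ Icc (0 : ℝ) (1/3), F x ≤ A * (x - 1/6) ^ 2 + B * (x - 1/6) + C) :
    ∫ x, F x ∂μ ≤ A * (1/72) + C :=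
  integral_le_of_le_quadratic (ae_mem_Icc_left hμ) (integral_id_left hμ) (integral_sq_left hμ)
    hF A B C h

lemma mem_support_left (hμ : IsCantorLeft μ) :
    (0 : ℝ) ∈ μ.support ∧ (1/3 : ℝ) ∈ μ.support ∧ μ.support.Infinite := by
  have h1 : (2 : ℝ≥0∞)⁻¹ • μ.map (fun x => x / 3) ≤ μ := by
    conv_rhs => rw [hμ]
    exact Measure.le_add_right le_rfl
  have h2 : (2 : ℝ≥0∞)⁻¹ • μ.map (fun x => x / 3 + 2/9) ≤ μ := by
    conv_rhs => rw [hμ]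
    exact Measure.le_add_left le_rfl
  have s1 : (1/3 : ℝ) ∈ μ.support :=
    fixedPoint_mem_support (r := 1/3) (by fun_prop) h2 (by norm_num) (by norm_num) fun x => by ring
  refine ⟨fixedPoint_mem_support (r := 1/3) (by fun_prop) h1 (by norm_num) (by norm_num)
    fun x => by ring, s1, ?_⟩
  refine Set.infinite_of_injective_forall_mem (f := fun k : ℕ => (1/3 : ℝ) ^ (k + 1)) ?_ ?_
  · intro i j hij
    have := pow_right_injective₀ (show (0 : ℝ) < 1/3 by norm_num) (by norm_num) hij
    simpa using this
  · intro k
    induction k with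
    | zero => simpa using s1
    | succ k ih =>
      have := map_mem_support (f := fun x => x / 3) (by fun_prop) h1 ih
      simpa [pow_succ, div_eq_mul_inv] using this

end Left

section Right

variable {μ : Measure ℝ} [IsProbabilityMeasure μ]

lemma ae_mem_Icc_right (hμ : IsCantorRight μ) : ∀ᵐ x ∂μ, x ∈ Icc (2/3 : ℝ) 1 := by
  have h1 := ae_nonpos_of_selfSimilar (v := fun x => 2/3 - x) (by fun_prop)
    (by fun_prop) hμ (by fun_prop) (fun x h => by linarith)
    (fun x h => by linarith)
  have h2 := ae_nonpos_of_selfSimilar (v := fun x => x - 1) (by fun_prop)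
    (by fun_prop) hμ (by fun_prop) (fun x h => by linarith)
    (fun x h => by linarith)
  filter_upwards [h1, h2] with x hx hx'
  constructor <;> linarith

lemma integral_right (hμ : IsCantorRight μ) {F : ℝ → ℝ} (hF : Continuous F) :
    ∫ x, F x ∂μ = (1 / 2) * ∫ x, F (x / 4 + 1/2) ∂μ + (1 / 2) * ∫ x, F (x / 4 + 3/4) ∂μ :=
  integral_selfSimilar (by fun_prop) (by fun_prop) hμ
    (fun _ => integrable_of_ae_mem_Icc (ae_mem_Icc_right hμ)) hF

lemma integral_id_right (hμ : IsCantorRight μ) : ∫ x, x ∂μ = 5/6 := by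
  have h := integral_right hμ (F := fun x => x) (by fun_prop)
  rw [integral_add (integrable_of_ae_mem_Icc (ae_mem_Icc_right hμ) (by fun_prop)) (by fun_prop),
    integral_add (integrable_of_ae_mem_Icc (ae_mem_Icc_right hμ) (by fun_prop)) (by fun_prop),
    integral_div] at h
  simp at h
  linarith

lemma integral_sq_right (hμ : IsCantorRight μ) : ∫ x, (x - 5/6) ^ 2 ∂μ = 1/60 := by
  have h := integral_right hμ (F := fun x => (x - 5/6) ^ 2) (by fun_prop)
  have q := integral_centered_quadratic (ae_mem_Icc_right hμ) (integral_id_right hμ) rfl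
  have e1 := q (1/16) (-1/16) (1/64)
  have e2 := q (1/16) (1/16) (1/64)
  have f1 : ∀ x : ℝ, (x / 4 + 1/2 - 5/6) ^ 2 = 1/16 * (x - 5/6) ^ 2 + -1/16 * (x - 5/6) + 1/64 :=
    fun x => by ring
  have f2 : ∀ x : ℝ, (x / 4 + 3/4 - 5/6) ^ 2 = 1/16 * (x - 5/6) ^ 2 + 1/16 * (x - 5/6) + 1/64 :=
    fun x => by ring
  simp_rw [f1, f2] at h
  rw [e1, e2] at h
  linarith

lemma le_integral_right (hμ : IsCantorRight μ) {F : ℝ → ℝ} (hF : Continuous F) (A B C : ℝ)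
    (h : ∀ x ∈ Icc (2/3 : ℝ) 1, A * (x - 5/6) ^ 2 + B * (x - 5/6) + C ≤ F x) :
    A * (1/60) + C ≤ ∫ x, F x ∂μ :=
  le_integral_of_quadratic_le (ae_mem_Icc_right hμ) (integral_id_right hμ) (integral_sq_right hμ)
    hF A B C h

lemma integral_right_le (hμ : IsCantorRight μ) {F : ℝ → ℝ} (hF : Continuous F) (A B C : ℝ)
    (h : ∀ x ∈ Icc (2/3 : ℝ) 1, F x ≤ A * (x - 5/6) ^ 2 + B * (x - 5/6) + C) :
    ∫ x, F x ∂μ ≤ A * (1/60) + C :=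
  integral_le_of_le_quadratic (ae_mem_Icc_right hμ) (integral_id_right hμ) (integral_sq_right hμ)
    hF A B C h

lemma mem_support_right (hμ : IsCantorRight μ) :
    (2/3 : ℝ) ∈ μ.support ∧ (1 : ℝ) ∈ μ.support := by
  have h1 : (2 : ℝ≥0∞)⁻¹ • μ.map (fun x => x / 4 + 1/2) ≤ μ := by
    conv_rhs => rw [hμ]
    exact Measure.le_add_right le_rfl
  have h2 : (2 : ℝ≥0∞)⁻¹ • μ.map (fun x => x / 4 + 3/4) ≤ μ := by
    conv_rhs => rw [hμ]
    exact Measure.le_add_left le_rfl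
  constructor
  · refine fixedPoint_mem_support (r := 1/4) (by fun_prop) h1 (by norm_num) (by norm_num)
      fun x => by ring
  · refine fixedPoint_mem_support (r := 1/4) (by fun_prop) h2 (by norm_num) (by norm_num)
      fun x => by ring

end Right

section Bounds

lemma sq_sub_le_of_two_mul_le {t p d : ℝ} (h : p ≤ d) (h' : 2 * t ≤ p + d) :
    (t - p) ^ 2 ≤ (t - d) ^ 2 := by
  nlinarith [mul_nonneg (sub_nonneg.2 h) (sub_nonneg.2 h')]

lemma sq_sub_le_of_le_two_mul {t p d : ℝ} (h : d ≤ p) (h' : p + d ≤ 2 * t) :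
    (t - p) ^ 2 ≤ (t - d) ^ 2 := by
  nlinarith [mul_nonneg (sub_nonneg.2 h) (sub_nonneg.2 h')]

variable {μ : Measure ℝ} [IsProbabilityMeasure μ] {γ : Finset ℝ} {p c q : ℝ}

lemma integral_iInf_sq_nonneg (μ : Measure ℝ) (γ : Finset ℝ) (f : ℝ → ℝ) :
    0 ≤ ∫ x, (⨅ d : γ, (f x - (d : ℝ)) ^ 2) ∂μ :=
  integral_nonneg fun _ => iInf_sq_nonneg γ _

lemma left_bound_of_third_le (hμ : IsCantorLeft μ) (hγ : γ.Nonempty) (h : ∀ d ∈ γ, 1/3 ≤ d) :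
    1/24 ≤ ∫ x, (⨅ d : γ, (x - (d : ℝ)) ^ 2) ∂μ := by
  refine le_trans (by norm_num) (le_integral_left hμ (continuous_iInf_sq hγ) 1 (-1/3) (1/36) ?_)
  rintro x ⟨hx0, hx1⟩
  refine le_iInf_sq hγ fun d hd => ?_
  have := sq_sub_le_of_two_mul_le (t := x) (h d hd) (by linarith [h d hd])
  nlinarith

lemma right_bound_of_le_two_thirds (hμ : IsCantorRight μ) (hγ : γ.Nonempty)
    (h : ∀ d ∈ γ, d ≤ 2/3) : 2/45 ≤ ∫ x, (⨅ d : γ, (x - (d : ℝ)) ^ 2) ∂μ := by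
  refine le_trans (by norm_num) (le_integral_right hμ (continuous_iInf_sq hγ) 1 (1/3) (1/36) ?_)
  rintro x ⟨hx0, hx1⟩
  refine le_iInf_sq hγ fun d hd => ?_
  have := sq_sub_le_of_le_two_mul (t := x) (h d hd) (by linarith [h d hd])
  nlinarith

lemma left_bound_of_gap (hμ : IsCantorLeft μ) (hγ : γ.Nonempty)
    (h : ∀ d ∈ γ, d ≤ 1/6 ∨ 1/2 ≤ d) :
    1/144 ≤ ∫ x, (⨅ d : γ, (x - (d : ℝ)) ^ 2) ∂μ := by
  rw [integral_left hμ (continuous_iInf_sq hγ)]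
  have h1 := integral_iInf_sq_nonneg μ γ (fun x => x / 3)
  have h2 := le_integral_left hμ (F := fun x => ⨅ d : γ, (x / 3 + 2/9 - (d : ℝ)) ^ 2)
    ((continuous_iInf_sq hγ).comp (by fun_prop)) (1/9) (2/27) (1/81) (by
      rintro x ⟨hx0, hx1⟩
      refine le_iInf_sq hγ fun d hd => ?_
      have : (x / 3 + 2/9 - 1/6) ^ 2 ≤ (x / 3 + 2/9 - d) ^ 2 := by
        rcases h d hd with h | h
        · exact sq_sub_le_of_le_two_mul h (by linarith)
        · exact sq_sub_le_of_two_mul_le (by linarith) (by linarith)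
      nlinarith)
  linarith

lemma right_bound_of_gap (hμ : IsCantorRight μ) (hγ : γ.Nonempty)
    (h : ∀ d ∈ γ, d ≤ 1/2 ∨ 5/6 ≤ d) :
    1/120 ≤ ∫ x, (⨅ d : γ, (x - (d : ℝ)) ^ 2) ∂μ := by
  rw [integral_right hμ (continuous_iInf_sq hγ)]
  have h1 := integral_iInf_sq_nonneg μ γ (fun x => x / 4 + 3/4)
  have h2 := le_integral_right hμ (F := fun x => ⨅ d : γ, (x / 4 + 1/2 - (d : ℝ)) ^ 2)
    ((continuous_iInf_sq hγ).comp (by fun_prop)) (1/16) (-1/16) (1/64) (by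
      rintro x ⟨hx0, hx1⟩
      refine le_iInf_sq hγ fun d hd => ?_
      have : (x / 4 + 1/2 - 5/6) ^ 2 ≤ (x / 4 + 1/2 - d) ^ 2 := by
        rcases h d hd with h | h
        · exact sq_sub_le_of_le_two_mul (by linarith) (by linarith)
        · exact sq_sub_le_of_two_mul_le (by linarith) (by linarith)
      nlinarith)
  linarith

lemma left_bound_of_one_point (hμ : IsCantorLeft μ) (hγ : γ.Nonempty) (hp0 : 0 ≤ p)
    (h : ∀ d ∈ γ, d = p ∨ 1/3 ≤ d) :
    1/1296 ≤ ∫ x, (⨅ d : γ, (x - (d : ℝ)) ^ 2) ∂μ := by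
  rw [integral_left hμ (continuous_iInf_sq hγ)]
  have h1 := integral_iInf_sq_nonneg μ γ (fun x => x / 3 + 2/9)
  obtain ⟨e, he0, he1, he⟩ : ∃ e : ℝ, 0 ≤ e ∧ e ≤ 1/6 ∧
      ∀ t : ℝ, t ≤ 1/9 → 0 ≤ t → (t - e) ^ 2 ≤ (t - p) ^ 2 := by
    rcases le_total p (1/6) with hp | hp
    · exact ⟨p, hp0, hp, fun _ _ _ => le_rfl⟩
    · exact ⟨1/6, by norm_num, le_rfl, fun t h1 h2 =>
        sq_sub_le_of_two_mul_le (by linarith) (by linarith)⟩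
  have h2 := le_integral_left hμ (F := fun x => ⨅ d : γ, (x / 3 - (d : ℝ)) ^ 2)
    ((continuous_iInf_sq hγ).comp (by fun_prop)) (1/9) (2/3 * (1/18 - e)) ((1/18 - e) ^ 2) (by
      rintro x ⟨hx0, hx1⟩
      refine le_iInf_sq hγ fun d hd => ?_
      have : (x / 3 - e) ^ 2 ≤ (x / 3 - d) ^ 2 := by
        rcases h d hd with rfl | h
        · exact he _ (by linarith) (by linarith)
        · exact sq_sub_le_of_two_mul_le (by linarith) (by linarith)
      nlinarith)
  nlinarith [sq_nonneg (1/18 - e)]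

lemma right_bound_of_half_le (hμ : IsCantorRight μ) (hγ : γ.Nonempty) (hc : c ≤ 2/3)
    (hq : q ≤ 1) (h : ∀ d ∈ γ, d ≤ c ∨ d = q) :
    1/720 + 1/1920 ≤ ∫ x, (⨅ d : γ, (x - (d : ℝ)) ^ 2) ∂μ := by
  rw [integral_right hμ (continuous_iInf_sq hγ)]
  have cT : Continuous fun x => ⨅ d : γ, (x / 4 + 1/2 - (d : ℝ)) ^ 2 :=
    (continuous_iInf_sq hγ).comp (by fun_prop)
  have cT' : Continuous fun x => ⨅ d : γ, (x / 4 + 3/4 - (d : ℝ)) ^ 2 :=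
    (continuous_iInf_sq hγ).comp (by fun_prop)
  rcases le_total q (5/6) with hq' | hq'
  · have h1 := integral_iInf_sq_nonneg μ γ (fun x => x / 4 + 1/2)
    have h2 := le_integral_right hμ cT' (1/16) (1/16) (1/64) (by
      rintro x ⟨hx0, hx1⟩
      refine le_iInf_sq hγ fun d hd => ?_
      have hd' : d ≤ 5/6 := by rcases h d hd with h | h <;> linarith
      have : (x / 4 + 3/4 - 5/6) ^ 2 ≤ (x / 4 + 3/4 - d) ^ 2 :=
        sq_sub_le_of_le_two_mul hd' (by linarith)
      nlinarith)
    linarith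
  · have h1 := le_integral_right hμ cT (1/16) (1/48) (1/576) (by
      rintro x ⟨hx0, hx1⟩
      refine le_iInf_sq hγ fun d hd => ?_
      have : (x / 4 + 1/2 - 2/3) ^ 2 ≤ (x / 4 + 1/2 - d) ^ 2 := by
        rcases h d hd with h | rfl
        · exact sq_sub_le_of_le_two_mul (by linarith) (by linarith)
        · exact sq_sub_le_of_two_mul_le (by linarith) (by linarith)
      nlinarith)
    have h2 := le_integral_right hμ cT' (1/16) (1/2 * (23/24 - q)) ((23/24 - q) ^ 2) (by
      rintro x ⟨hx0, hx1⟩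
      refine le_iInf_sq hγ fun d hd => ?_
      have : (x / 4 + 3/4 - q) ^ 2 ≤ (x / 4 + 3/4 - d) ^ 2 := by
        rcases h d hd with h | rfl
        · exact sq_sub_le_of_le_two_mul (by linarith) (by linarith)
        · exact le_rfl
      nlinarith)
    nlinarith [sq_nonneg (23/24 - q)]

lemma left_bound_of_half_le (hμ : IsCantorLeft μ) (hγ : γ.Nonempty) (hp0 : 0 ≤ p)
    (hp : p ≤ 1/6) (h : ∀ d ∈ γ, d = p ∨ 1/2 ≤ d) :
    1/72 - 1/2016 ≤ ∫ x, (⨅ d : γ, (x - (d : ℝ)) ^ 2) ∂μ := by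
  have cR : Continuous fun x => ⨅ d : γ, (x / 3 + 2/9 - (d : ℝ)) ^ 2 :=
    (continuous_iInf_sq hγ).comp (by fun_prop)
  have cR1 : Continuous fun x => ⨅ d : γ, (x / 3 / 3 + 2/9 - (d : ℝ)) ^ 2 :=
    cR.comp (by fun_prop : Continuous fun x : ℝ => x / 3)
  have cR2 : Continuous fun x => ⨅ d : γ, ((x / 3 + 2/9) / 3 + 2/9 - (d : ℝ)) ^ 2 :=
    cR.comp (by fun_prop : Continuous fun x : ℝ => x / 3 + 2/9)
  rw [integral_left hμ (continuous_iInf_sq hγ), integral_left hμ cR]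
  have hL := le_integral_left hμ (F := fun x => ⨅ d : γ, (x / 3 - (d : ℝ)) ^ 2)
    ((continuous_iInf_sq hγ).comp (by fun_prop)) (1/9) (2/3 * (1/18 - p)) ((1/18 - p) ^ 2) (by
      rintro x ⟨hx0, hx1⟩
      refine le_iInf_sq hγ fun d hd => ?_
      have : (x / 3 - p) ^ 2 ≤ (x / 3 - d) ^ 2 := by
        rcases h d hd with rfl | h
        · exact le_rfl
        · exact sq_sub_le_of_two_mul_le (by linarith) (by linarith)
      nlinarith)
  rcases le_total p (5/54) with hp' | hp'
  · have h1 := le_integral_left hμ cR1 (1/81) (2/9 * (8/54)) ((8/54) ^ 2) (by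
      rintro x ⟨hx0, hx1⟩
      refine le_iInf_sq hγ fun d hd => ?_
      have : (x / 3 / 3 + 2/9 - 5/54) ^ 2 ≤ (x / 3 / 3 + 2/9 - d) ^ 2 := by
        rcases h d hd with rfl | h
        · exact sq_sub_le_of_le_two_mul (by linarith) (by linarith)
        · exact sq_sub_le_of_two_mul_le (by linarith) (by linarith)
      nlinarith)
    have h2 := le_integral_left hμ cR2 (1/81) (-2/9 * (10/54)) ((10/54) ^ 2) (by
      rintro x ⟨hx0, hx1⟩
      refine le_iInf_sq hγ fun d hd => ?_
      have : ((x / 3 + 2/9) / 3 + 2/9 - 1/2) ^ 2 ≤ ((x / 3 + 2/9) / 3 + 2/9 - d) ^ 2 := by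
        rcases h d hd with rfl | h
        · exact sq_sub_le_of_le_two_mul (by linarith) (by linarith)
        · exact sq_sub_le_of_two_mul_le (by linarith) (by linarith)
      nlinarith)
    nlinarith [sq_nonneg (1/18 - p)]
  · have h1 := le_integral_left hμ cR1 (1/81) (2/9 * (13/54 - p)) ((13/54 - p) ^ 2) (by
      rintro x ⟨hx0, hx1⟩
      refine le_iInf_sq hγ fun d hd => ?_
      have : (x / 3 / 3 + 2/9 - p) ^ 2 ≤ (x / 3 / 3 + 2/9 - d) ^ 2 := by
        rcases h d hd with rfl | h
        · exact le_rfl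
        · exact sq_sub_le_of_two_mul_le (by linarith) (by linarith)
      nlinarith)
    have h2 := le_integral_left hμ cR2 (1/81)
      (2/9 * (17/54 - p) - 3 * (1/2 - p) * (1/6 - p))
      ((17/54 - p) ^ 2 - (1/2 - p) * (1/6 - p) / 2) (by
      rintro x ⟨hx0, hx1⟩
      refine le_iInf_sq hγ fun d hd => ?_
      have hs : 0 ≤ (1/2 - p) * (1/6 - p) := mul_nonneg (by linarith) (by linarith)
      have : ((x / 3 + 2/9) / 3 + 2/9 - p) ^ 2 - (1/2 - p) * (1/6 - p) * (3 * x) ≤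
          ((x / 3 + 2/9) / 3 + 2/9 - d) ^ 2 := by
        rcases h d hd with rfl | h
        · nlinarith [mul_nonneg hs hx0]
        · refine le_trans ?_ (sq_sub_le_of_two_mul_le h (by linarith))
          have h3 : 0 ≤ (1/3 - x) * (p - 5/54) := mul_nonneg (by linarith) (by linarith)
          have h4 : 2 * (x / 9 + 8/27) - 2/3 + (1/6 - p) ≤ (1/6 - p) * (3 * x) := by nlinarith
          nlinarith [mul_le_mul_of_nonneg_left h4 (show 0 ≤ 1/2 - p by linarith)]
      nlinarith)
    nlinarith [sq_nonneg (1/6 - p - 1/42)]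

lemma right_bound_of_le_half (hμ : IsCantorRight μ) (hγ : γ.Nonempty) (hq0 : 5/6 ≤ q)
    (hq : q ≤ 1) (h : ∀ d ∈ γ, d ≤ 1/2 ∨ d = q) :
    1/60 - 1/432 ≤ ∫ x, (⨅ d : γ, (x - (d : ℝ)) ^ 2) ∂μ := by
  rw [integral_right hμ (continuous_iInf_sq hγ)]
  have cT : Continuous fun x => ⨅ d : γ, (x / 4 + 1/2 - (d : ℝ)) ^ 2 :=
    (continuous_iInf_sq hγ).comp (by fun_prop)
  have cT' : Continuous fun x => ⨅ d : γ, (x / 4 + 3/4 - (d : ℝ)) ^ 2 :=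
    (continuous_iInf_sq hγ).comp (by fun_prop)
  have h1 := le_integral_right hμ cT (1/16)
    (-1/2 * (q - 17/24) + 3 * (q - 1/2) * (q - 5/6))
    ((q - 17/24) ^ 2 - (q - 1/2) * (q - 5/6) / 2) (by
      rintro x ⟨hx0, hx1⟩
      refine le_iInf_sq hγ fun d hd => ?_
      have hs : 0 ≤ (q - 1/2) * (q - 5/6) := mul_nonneg (by linarith) (by linarith)
      have : (x / 4 + 1/2 - q) ^ 2 - (q - 1/2) * (q - 5/6) * (3 - 3 * x) ≤
          (x / 4 + 1/2 - d) ^ 2 := by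
        rcases h d hd with h | rfl
        · refine le_trans ?_ (sq_sub_le_of_le_two_mul h (by linarith))
          have h3 : 0 ≤ (x - 2/3) * (1 - q) := mul_nonneg (by linarith) (by linarith)
          have h4 : q + 1/2 - 2 * (x / 4 + 1/2) ≤ (q - 5/6) * (3 - 3 * x) := by nlinarith
          nlinarith [mul_le_mul_of_nonneg_left h4 (show 0 ≤ q - 1/2 by linarith)]
        · nlinarith [mul_nonneg hs (sub_nonneg.2 hx1)]
      nlinarith)
  have h2 := le_integral_right hμ cT' (1/16) (1/2 * (23/24 - q)) ((23/24 - q) ^ 2) (by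
      rintro x ⟨hx0, hx1⟩
      refine le_iInf_sq hγ fun d hd => ?_
      have : (x / 4 + 3/4 - q) ^ 2 ≤ (x / 4 + 3/4 - d) ^ 2 := by
        rcases h d hd with h | rfl
        · exact sq_sub_le_of_le_two_mul (by linarith) (by linarith)
        · exact le_rfl
      nlinarith)
  nlinarith [sq_nonneg (q - 5/6 - 1/18)]

end Bounds

section Mixture

variable {P₁ P₂ : Measure ℝ} [IsProbabilityMeasure P₁] [IsProbabilityMeasure P₂] {γ : Finset ℝ}

lemma integrable_mix (h₁ : IsCantorLeft P₁) (h₂ : IsCantorRight P₂) {F : ℝ → ℝ}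
    (hF : Continuous F) : Integrable F (mix P₁ P₂) :=
  ((integrable_of_ae_mem_Icc (ae_mem_Icc_left h₁) hF).smul_measure (by simp)).add_measure
    ((integrable_of_ae_mem_Icc (ae_mem_Icc_right h₂) hF).smul_measure (by simp))

lemma distortion_mix (h₁ : IsCantorLeft P₁) (h₂ : IsCantorRight P₂) (hγ : γ.Nonempty) :
    distortion (mix P₁ P₂) γ = 1/2 * ∫ x, (⨅ d : γ, (x - (d : ℝ)) ^ 2) ∂P₁ +
      1/2 * ∫ x, (⨅ d : γ, (x - (d : ℝ)) ^ 2) ∂P₂ := by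
  have hF := continuous_iInf_sq hγ
  rw [distortion, mix, integral_add_measure
    ((integrable_of_ae_mem_Icc (ae_mem_Icc_left h₁) hF).smul_measure (by simp))
    ((integrable_of_ae_mem_Icc (ae_mem_Icc_right h₂) hF).smul_measure (by simp)),
    integral_smul_measure, integral_smul_measure]
  simp

lemma ae_mix_mem (h₁ : IsCantorLeft P₁) (h₂ : IsCantorRight P₂) :
    ∀ᵐ x ∂(mix P₁ P₂), x ∈ Icc (0 : ℝ) (1/3) ∨ x ∈ Icc (2/3 : ℝ) 1 := by
  rw [mix, ae_add_measure_iff]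
  exact ⟨Measure.ae_smul_measure ((ae_mem_Icc_left h₁).mono fun _ => Or.inl) _,
    Measure.ae_smul_measure ((ae_mem_Icc_right h₂).mono fun _ => Or.inr) _⟩

lemma support_mix (P₁ P₂ : Measure ℝ) : (mix P₁ P₂).support = P₁.support ∪ P₂.support := by
  have h : ∀ μ : Measure ℝ, ((2 : ℝ≥0∞)⁻¹ • μ).support = μ.support := fun μ => by
    ext x
    simp [Measure.mem_support_iff_forall]
  rw [mix, Measure.support_add, h, h]

lemma quantErr_mix_le_of_two_le (h₁ : IsCantorLeft P₁) (h₂ : IsCantorRight P₂) {n : ℕ}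
    (hn : 2 ≤ n) : quantErr (mix P₁ P₂) n ≤ 1/2 * (1/72) + 1/2 * (1/60) := by
  have hγ : ({1/6, 5/6} : Finset ℝ).Nonempty := by simp
  refine (quantErr_le_distortion hγ (Finset.card_le_two.trans hn)).trans ?_
  rw [distortion_mix h₁ h₂ hγ]
  have a := integral_left_le h₁ (continuous_iInf_sq hγ) 1 0 0 fun x _ =>
    (iInf_sq_le (c := 1/6) (by simp) x).trans_eq (by ring)
  have b := integral_right_le h₂ (continuous_iInf_sq hγ) 1 0 0 fun x _ =>
    (iInf_sq_le (c := 5/6) (by simp) x).trans_eq (by ring)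
  linarith

lemma right_le_of_mem (h₂ : IsCantorRight P₂) (h : 17/24 ∈ γ) (h' : 23/24 ∈ γ) :
    ∫ x, (⨅ d : γ, (x - (d : ℝ)) ^ 2) ∂P₂ ≤ 1/960 := by
  have hF := continuous_iInf_sq ⟨_, h⟩
  rw [integral_right h₂ hF]
  have a := integral_right_le h₂ (hF.comp (by fun_prop : Continuous fun x : ℝ => x / 4 + 1/2))
    (1/16) 0 0 fun x _ => (iInf_sq_le h _).trans_eq (by ring)
  have b := integral_right_le h₂ (hF.comp (by fun_prop : Continuous fun x : ℝ => x / 4 + 3/4))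
    (1/16) 0 0 fun x _ => (iInf_sq_le h' _).trans_eq (by ring)
  simp only [Function.comp_apply] at a b
  linarith

lemma left_le_of_mem (h₁ : IsCantorLeft P₁) (h : 1/18 ∈ γ) (h' : 5/18 ∈ γ) :
    ∫ x, (⨅ d : γ, (x - (d : ℝ)) ^ 2) ∂P₁ ≤ 1/648 := by
  have hF := continuous_iInf_sq ⟨_, h⟩
  rw [integral_left h₁ hF]
  have a := integral_left_le h₁ (hF.comp (by fun_prop : Continuous fun x : ℝ => x / 3))
    (1/9) 0 0 fun x _ => (iInf_sq_le h _).trans_eq (by ring)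
  have b := integral_left_le h₁ (hF.comp (by fun_prop : Continuous fun x : ℝ => x / 3 + 2/9))
    (1/9) 0 0 fun x _ => (iInf_sq_le h' _).trans_eq (by ring)
  simp only [Function.comp_apply] at a b
  linarith

lemma quantErr_mix_le_of_three_le (h₁ : IsCantorLeft P₁) (h₂ : IsCantorRight P₂) {n : ℕ}
    (hn : 3 ≤ n) : quantErr (mix P₁ P₂) n ≤ 1/2 * (1/72) + 1/2 * (1/960) := by
  have hγ : ({1/6, 17/24, 23/24} : Finset ℝ).Nonempty := by simp
  refine (quantErr_le_distortion hγ (Finset.card_le_three.trans hn)).trans ?_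
  rw [distortion_mix h₁ h₂ hγ]
  have a := integral_left_le h₁ (continuous_iInf_sq hγ) 1 0 0 fun x _ =>
    (iInf_sq_le (c := 1/6) (by simp) x).trans_eq (by ring)
  have b := right_le_of_mem h₂ (γ := {1/6, 17/24, 23/24}) (by simp) (by simp)
  linarith

lemma quantErr_mix_le_of_four_le (h₁ : IsCantorLeft P₁) (h₂ : IsCantorRight P₂) {n : ℕ}
    (hn : 4 ≤ n) : quantErr (mix P₁ P₂) n ≤ 1/2 * (1/648) + 1/2 * (1/960) := by
  have hγ : ({1/18, 5/18, 17/24, 23/24} : Finset ℝ).Nonempty := by simp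
  refine (quantErr_le_distortion hγ (Finset.card_le_four.trans hn)).trans ?_
  rw [distortion_mix h₁ h₂ hγ]
  have a := left_le_of_mem h₁ (γ := {1/18, 5/18, 17/24, 23/24}) (by simp) (by simp)
  have b := right_le_of_mem h₂ (γ := {1/18, 5/18, 17/24, 23/24}) (by simp) (by simp)
  linarith

lemma lt_distortion_of_three_points (h₁ : IsCantorLeft P₁) (h₂ : IsCantorRight P₂)
    (hγ : γ.Nonempty) {p c q : ℝ} (hp : 0 ≤ p) (hc : 1/3 ≤ c) (hc' : c ≤ 2/3) (hq : q ≤ 1)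
    (hpc : p ≤ 2/3 - c) (hcq : 4/3 - c ≤ q) (h : ∀ d ∈ γ, d = p ∨ d = c ∨ d = q) :
    1/2 * (1/72) + 1/2 * (1/960) < distortion (mix P₁ P₂) γ := by
  rw [distortion_mix h₁ h₂ hγ]
  rcases le_total c (1/2) with hh | hh
  · have a := left_bound_of_one_point h₁ hγ hp fun d hd => by
      rcases h d hd with h | h | h
      · exact Or.inl h
      · right; linarith
      · right; linarith
    have b := right_bound_of_le_half h₂ hγ (q := q) (by linarith) hq fun d hd => by
      rcases h d hd with h | h | h
      · left; linarith
      · left; linarith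
      · exact Or.inr h
    linarith
  · have a := left_bound_of_half_le h₁ hγ (p := p) hp (by linarith) fun d hd => by
      rcases h d hd with h | h | h
      · exact Or.inl h
      · right; linarith
      · right; linarith
    have b := right_bound_of_half_le h₂ hγ (c := c) hc' hq fun d hd => by
      rcases h d hd with h | h | h
      · left; linarith
      · left; linarith
      · exact Or.inr h
    linarith

lemma IsOptimalSet.mem_Icc (h₁ : IsCantorLeft P₁) (h₂ : IsCantorRight P₂) {n : ℕ}
    (hγ : IsOptimalSet (mix P₁ P₂) n γ) {c : ℝ} (hc : c ∈ γ) : c ∈ Icc (0 : ℝ) 1 := by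
  have hFint : ∀ F : ℝ → ℝ, Continuous F → Integrable F (mix P₁ P₂) :=
    fun _ => integrable_mix h₁ h₂
  have hinf : (mix P₁ P₂).support.Infinite := by
    rw [support_mix]
    exact (mem_support_left h₁).2.2.mono subset_union_left
  constructor
  · by_contra! h0
    refine hγ.not_ae_dominated_insert hFint hinf hc (z := 0)
      (support_mix P₁ P₂ ▸ Or.inl (mem_support_left h₁).1) h0.ne' ?_
    filter_upwards [ae_mix_mem h₁ h₂] with x hx
    have : 0 ≤ x := by rcases hx with h | h <;> linarith [h.1]
    exact Or.inr (sq_sub_le_of_le_two_mul h0.le (by linarith))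
  · by_contra! h0
    refine hγ.not_ae_dominated_insert hFint hinf hc (z := 1)
      (support_mix P₁ P₂ ▸ Or.inr (mem_support_right h₂).2) h0.ne ?_
    filter_upwards [ae_mix_mem h₁ h₂] with x hx
    have : x ≤ 1 := by rcases hx with h | h <;> linarith [h.2]
    exact Or.inr (sq_sub_le_of_two_mul_le h0.le (by linarith))

/-- The Voronoi cell of a point of an optimal set in the gap `(1/3, 2/3)` reaches into both
components of the support. -/
lemma IsOptimalSet.neighbours_of_mem_gap (h₁ : IsCantorLeft P₁) (h₂ : IsCantorRight P₂) {n : ℕ}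
    (hγ : IsOptimalSet (mix P₁ P₂) n γ) {c : ℝ} (hc : c ∈ γ) (hcg : c ∈ Ioo (1/3 : ℝ) (2/3))
    {d : ℝ} (hd : d ∈ γ) : (d < c → d < 2/3 - c) ∧ (c < d → 4/3 - c < d) := by
  have hFint : ∀ F : ℝ → ℝ, Continuous F → Integrable F (mix P₁ P₂) :=
    fun _ => integrable_mix h₁ h₂
  have hinf : (mix P₁ P₂).support.Infinite := by
    rw [support_mix]
    exact (mem_support_left h₁).2.2.mono subset_union_left
  constructor
  · intro hdc
    by_contra! h
    refine hγ.not_ae_dominated_insert hFint hinf hc (z := 2/3)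
      (support_mix P₁ P₂ ▸ Or.inr (mem_support_right h₂).1) hcg.2.ne' ?_
    filter_upwards [ae_mix_mem h₁ h₂] with x hx
    rcases hx with hx | hx
    · exact Or.inl ⟨d, hd, hdc.ne, sq_sub_le_of_two_mul_le hdc.le (by linarith [hx.2])⟩
    · exact Or.inr (sq_sub_le_of_le_two_mul hcg.2.le (by linarith [hx.1, hcg.2]))
  · intro hdc
    by_contra! h
    refine hγ.not_ae_dominated_insert hFint hinf hc (z := 1/3)
      (support_mix P₁ P₂ ▸ Or.inl (mem_support_left h₁).2.1) hcg.1.ne ?_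
    filter_upwards [ae_mix_mem h₁ h₂] with x hx
    rcases hx with hx | hx
    · exact Or.inr (sq_sub_le_of_two_mul_le hcg.1.le (by linarith [hx.2, hcg.1]))
    · exact Or.inl ⟨d, hd, hdc.ne', sq_sub_le_of_le_two_mul hdc.le (by linarith [hx.1])⟩

end Mixture

theorem stmt17 (P₁ P₂ : Measure ℝ) [IsProbabilityMeasure P₁] [IsProbabilityMeasure P₂]
    (hP₁ : P₁ = (2 : ℝ≥0∞)⁻¹ • P₁.map (fun x => x / 3) +
      (2 : ℝ≥0∞)⁻¹ • P₁.map (fun x => x / 3 + 2/9))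
    (hP₂ : P₂ = (2 : ℝ≥0∞)⁻¹ • P₂.map (fun x => x / 4 + 1/2) +
      (2 : ℝ≥0∞)⁻¹ • P₂.map (fun x => x / 4 + 3/4))
    (P : Measure ℝ) (hP : P = mix P₁ P₂)
    (n : ℕ) (hn : 2 ≤ n) (γ : Finset ℝ) (hγ : IsOptimalSet P n γ) :
    (∃ c ∈ γ, c ∈ Ico (0 : ℝ) (1/3)) ∧ (∃ c ∈ γ, c ∈ Ioc (2/3 : ℝ) 1) ∧
    ∀ c ∈ γ, c ∉ Ioo (1/3 : ℝ) (2/3) := by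
  subst hP
  have hV : distortion (mix P₁ P₂) γ = quantErr (mix P₁ P₂) n := hγ.2.2
  have hD := distortion_mix hP₁ hP₂ hγ.1
  have hI₁ := integral_iInf_sq_nonneg P₁ γ (fun x => x)
  have hI₂ := integral_iInf_sq_nonneg P₂ γ (fun x => x)
  have hV2 := quantErr_mix_le_of_two_le hP₁ hP₂ hn
  have hL : ∃ c ∈ γ, c ∈ Ico (0 : ℝ) (1/3) := by
    by_contra! h
    have := left_bound_of_third_le hP₁ hγ.1 fun d hd => by
      by_contra! hd'
      exact h d hd ⟨(hγ.mem_Icc hP₁ hP₂ hd).1, hd'⟩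
    linarith
  have hR : ∃ c ∈ γ, c ∈ Ioc (2/3 : ℝ) 1 := by
    by_contra! h
    have := right_bound_of_le_two_thirds hP₂ hγ.1 fun d hd => by
      by_contra! hd'
      exact h d hd ⟨hd', (hγ.mem_Icc hP₁ hP₂ hd).2⟩
    linarith
  refine ⟨hL, hR, fun c hc hcg => ?_⟩
  have hnb := fun d hd => hγ.neighbours_of_mem_gap hP₁ hP₂ hc hcg (d := d) hd
  rcases le_or_gt 4 n with h4 | h4
  · have hV4 := quantErr_mix_le_of_four_le hP₁ hP₂ h4
    rcases le_total c (1/2) with hh | hh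
    · have := right_bound_of_gap hP₂ hγ.1 fun d hd => by
        rcases le_or_gt d c with h | h
        · left; linarith
        · right; linarith [(hnb d hd).2 h]
      linarith
    · have := left_bound_of_gap hP₁ hγ.1 fun d hd => by
        rcases lt_or_ge d c with h | h
        · left; linarith [(hnb d hd).1 h]
        · right; linarith
      linarith
  · obtain ⟨p, hp, hp0, hp1⟩ := hL
    obtain ⟨q, hq, hq0, hq1⟩ := hR
    have hpc : p < c := hp1.trans hcg.1
    have hcq : c < q := hcg.2.trans hq0
    have hsub : ({p, c, q} : Finset ℝ) ⊆ γ := by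
      simp [Finset.insert_subset_iff, hp, hc, hq]
    have hcard : ({p, c, q} : Finset ℝ).card = 3 :=
      Finset.card_eq_three.2 ⟨p, c, q, hpc.ne, (hpc.trans hcq).ne, hcq.ne, rfl⟩
    have h3 : 3 ≤ n := hcard ▸ (Finset.card_le_card hsub).trans hγ.2.1
    have heq : ({p, c, q} : Finset ℝ) = γ :=
      Finset.eq_of_subset_of_card_le hsub (by rw [hcard]; exact hγ.2.1.trans (by omega))
    have := lt_distortion_of_three_points hP₁ hP₂ hγ.1 hp0 hcg.1.le hcg.2.le hq1
      ((hnb p hp).1 hpc).le ((hnb q hq).2 hcq).le fun d hd => by simpa [← heq] using hd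
    linarith [quantErr_mix_le_of_three_le hP₁ hP₂ h3]
end
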